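/- Let g = ⊕_{j∈ℤ} g_j be a ℤ-graded Lie algebra of depth q and height r satisfying conditions (1.6), and suppose 3 < q ≤ r. Let V be an irreducible g_0-submodule of g_{-q+1}, i.e. a nonzero subspace of g_{-q+1} with ⁅g_0, V⁆ ⊆ V whose only subspaces stable under ad g_0 are 0 and V. Then ⁅V, ⁅V, g_{q-1}⁆⁆ ≠ 0. -/

import Mathlib

/-- The sum of the negative homogeneous components of a graded Lie algebra. -/
def negPart {F L : Type*} [Field F] [LieRing L] [LieAlgebra F L]
    (g : ℤ → Submodule F L) : Submodule F L :=
  ⨆ j < (0 : ℤ), g j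

/-- The sum of the nonnegative homogeneous components of a graded Lie algebra. -/
def nonnegPart {F L : Type*} [Field F] [LieRing L] [LieAlgebra F L]
    (g : ℤ → Submodule F L) : Submodule F L :=
  ⨆ j ≥ (0 : ℤ), g j

/-- The linear span of all brackets `⁅x, y⁆` with `x ∈ A`, `y ∈ B`. -/
def bracketSpan {F L : Type*} [Field F] [LieRing L] [LieAlgebra F L]
    (A B : Submodule F L) : Submodule F L :=
  Submodule.span F {z : L | ∃ x ∈ A, ∃ y ∈ B, z = ⁅x, y⁆}

section GradedLie

variable {F L : Type*} [Field F] [LieRing L] [LieAlgebra F L]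

/-- `A` is stable under the adjoint action of `S`. -/
def AdStable (S A : Submodule F L) : Prop :=
  ∀ x ∈ S, ∀ a ∈ A, ⁅x, a⁆ ∈ A

/-- The only `S`-stable subspaces of `E` are `⊥` and `E`. -/
def AdIrreducible (S E : Submodule F L) : Prop :=
  ∀ W : Submodule F L, W ≤ E → AdStable S W → W = ⊥ ∨ W = E

/-- The elements which `A` brackets into `B`. -/
def transporter (A B : Submodule F L) : Submodule F L where
  carrier := {e | ∀ a ∈ A, ⁅a, e⁆ ∈ B}
  zero_mem' a _ := by simp
  add_mem' hx hy a ha := by simpa using B.add_mem (hx a ha) (hy a ha)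
  smul_mem' c x hx a ha := by simpa using B.smul_mem c (hx a ha)

theorem AdStable.transporter {S A B : Submodule F L} (hA : AdStable S A) (hB : AdStable S B) :
    AdStable S (transporter A B) := by
  intro x hx e he a ha
  have h : ⁅a, ⁅x, e⁆⁆ = ⁅x, ⁅a, e⁆⁆ - ⁅⁅x, a⁆, e⁆ := by
    rw [leibniz_lie x a e]; abel
  rw [h]
  exact B.sub_mem (hB x hx _ (he a ha)) (he _ (hA x hx a ha))

theorem AdStable.inf {S A B : Submodule F L} (hA : AdStable S A) (hB : AdStable S B) :
    AdStable S (A ⊓ B) :=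
  fun x hx a ha => ⟨hA x hx a ha.1, hB x hx a ha.2⟩

theorem adStable_bot (S : Submodule F L) : AdStable S ⊥ := by
  intro x _ a ha
  simp [(Submodule.mem_bot F).1 ha]

theorem lie_mem_bracketSpan {A B : Submodule F L} {a b : L} (ha : a ∈ A) (hb : b ∈ B) :
    ⁅a, b⁆ ∈ bracketSpan A B :=
  Submodule.subset_span ⟨a, ha, b, hb, rfl⟩

theorem bracketSpan_le {A B C : Submodule F L} :
    bracketSpan A B ≤ C ↔ ∀ a ∈ A, ∀ b ∈ B, ⁅a, b⁆ ∈ C := by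
  refine ⟨fun h a ha b hb => h (lie_mem_bracketSpan ha hb), fun h => Submodule.span_le.2 ?_⟩
  rintro _ ⟨a, ha, b, hb, rfl⟩
  exact h a ha b hb

theorem AdStable.bracketSpan {S A B : Submodule F L} (hA : AdStable S A) (hB : AdStable S B) :
    AdStable S (bracketSpan A B) := by
  intro x hx
  suffices h : _root_.bracketSpan A B ≤ (_root_.bracketSpan A B).comap
      (LieAlgebra.ad F L x : L →ₗ[F] L) from fun a ha => h ha
  refine bracketSpan_le.2 fun a ha b hb => ?_
  rw [Submodule.mem_comap, LieAlgebra.ad_apply, leibniz_lie]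
  exact Submodule.add_mem _ (lie_mem_bracketSpan (hA x hx a ha) hb)
    (lie_mem_bracketSpan ha (hB x hx b hb))

/-- In an irreducible module, a stable bracket condition satisfied by one nonzero vector is
satisfied by all of them. -/
theorem AdIrreducible.lie_mem {S E A B : Submodule F L} (hE : AdIrreducible S E)
    (hES : AdStable S E) (hA : AdStable S A) (hB : AdStable S B) {e₀ : L} (he₀ : e₀ ∈ E)
    (hne : e₀ ≠ 0) (h₀ : ∀ a ∈ A, ⁅a, e₀⁆ ∈ B) {a e : L} (ha : a ∈ A) (he : e ∈ E) :
    ⁅a, e⁆ ∈ B := by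
  rcases hE (E ⊓ transporter A B) inf_le_left (hES.inf (hA.transporter hB)) with h | h
  · have h₁ : e₀ ∈ E ⊓ transporter A B := ⟨he₀, h₀⟩
    rw [h] at h₁
    exact absurd ((Submodule.mem_bot F).1 h₁) hne
  · rw [← h] at he
    exact he.2 a ha

theorem AdIrreducible.lie_eq_zero {S E A : Submodule F L} (hE : AdIrreducible S E)
    (hES : AdStable S E) (hA : AdStable S A) {e₀ : L} (he₀ : e₀ ∈ E)
    (hne : e₀ ≠ 0) (h₀ : ∀ a ∈ A, ⁅a, e₀⁆ = 0) {a e : L} (ha : a ∈ A) (he : e ∈ E) :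
    ⁅a, e⁆ = 0 :=
  (Submodule.mem_bot F).1 <| hE.lie_mem hES hA (adStable_bot S) he₀ hne
    (fun a ha => (Submodule.mem_bot F).2 (h₀ a ha)) ha he

/-- If `⁅V, P⁆` centralizes `V`, each `⁅v, P⁆` is an ideal of `⁅V, P⁆`. When all of these act on
`K` with vanishing triple products, they have a common nonzero kernel. -/
theorem exists_common_kernel [FiniteDimensional F L] {S V P E : Submodule F L}
    (hPS : AdStable S P)
    (hIS : ∀ v ∈ V, ∀ x ∈ P, ⁅v, x⁆ ∈ S)
    (hIV : ∀ v ∈ V, ∀ x ∈ P, ∀ w ∈ V, ⁅⁅v, x⁆, w⁆ = 0)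
    (hnil : ∀ v ∈ V, ∀ x ∈ P, ∀ y ∈ P, ∀ z ∈ P, ∀ t ∈ E,
      ⁅⁅v, x⁆, ⁅⁅v, y⁆, ⁅⁅v, z⁆, t⁆⁆⁆ = 0)
    {A : Submodule F L} (hA : A ≤ V) :
    ∀ K : Submodule F L, K ≤ E → K ≠ ⊥ → (∀ v ∈ V, ∀ x ∈ P, ∀ t ∈ K, ⁅⁅v, x⁆, t⁆ ∈ K) →
      ∃ t ∈ K, t ≠ 0 ∧ ∀ v ∈ A, ∀ x ∈ P, ⁅⁅v, x⁆, t⁆ = 0 := by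
  induction A, IsNoetherian.noetherian A using Submodule.fg_induction with
  | singleton v =>
    intro K hKE hK hstab
    have hv : v ∈ V := hA (Submodule.mem_span_singleton_self v)
    suffices h : ∃ t ∈ K, t ≠ 0 ∧ ∀ x ∈ P, ⁅⁅v, x⁆, t⁆ = 0 by
      obtain ⟨t, htK, ht, h⟩ := h
      refine ⟨t, htK, ht, fun w hw x hx => ?_⟩
      obtain ⟨c, rfl⟩ := Submodule.mem_span_singleton.1 hw
      rw [smul_lie, smul_lie, h x hx, smul_zero]
    obtain ⟨t, htK, ht⟩ := (Submodule.ne_bot_iff K).1 hK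
    by_contra! hcon
    obtain ⟨z, hz, hz'⟩ := hcon t htK ht
    obtain ⟨y, hy, hy'⟩ := hcon _ (hstab v hv z hz t htK) hz'
    obtain ⟨x, hx, hx'⟩ := hcon _ (hstab v hv y hy _ (hstab v hv z hz t htK)) hy'
    exact hx' (hnil v hv x hx y hy z hz t (hKE htK))
  | sup A B _ _ ihA ihB =>
    intro K hKE hK hstab
    have hA' : A ≤ V := le_sup_left.trans hA
    have hB' : B ≤ V := le_sup_right.trans hA
    let K' : Submodule F L := K ⊓ transporter (bracketSpan A P) ⊥
    obtain ⟨t, htK, ht, hAt⟩ := ihA hA' K hKE hK hstab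
    have htK' : t ∈ K' := by
      refine ⟨htK, ?_⟩
      have : bracketSpan A P ≤ transporter (Submodule.span F {t}) ⊥ := by
        refine bracketSpan_le.2 fun a ha x hx b hb => ?_
        obtain ⟨c, rfl⟩ := Submodule.mem_span_singleton.1 hb
        rw [smul_lie, ← lie_skew, hAt a ha x hx]; simp
      intro h hh
      have := this hh t (Submodule.mem_span_singleton_self t)
      rw [← lie_skew]
      exact Submodule.neg_mem _ this
    obtain ⟨s, hs, hs0, hBs⟩ := ihB hB' K' (inf_le_left.trans hKE)
      ((Submodule.ne_bot_iff K').2 ⟨t, htK', ht⟩) (by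
        intro v hv x hx s hs
        refine ⟨hstab v hv x hx s hs.1, ?_⟩
        have hAst : AdStable (Submodule.span F {⁅v, x⁆}) (bracketSpan A P) := by
          refine AdStable.bracketSpan ?_ ?_
          · intro h hh a ha
            obtain ⟨c, rfl⟩ := Submodule.mem_span_singleton.1 hh
            rw [smul_lie, hIV v hv x hx a (hA' ha)]; simp
          · intro h hh a ha
            obtain ⟨c, rfl⟩ := Submodule.mem_span_singleton.1 hh
            rw [smul_lie]
            exact P.smul_mem c (hPS _ (hIS v hv x hx) a ha)
        exact hAst.transporter (adStable_bot _) _ (Submodule.mem_span_singleton_self _) s hs.2)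
    refine ⟨s, hs.1, hs0, fun v hv x hx => ?_⟩
    obtain ⟨a, ha, b, hb, rfl⟩ := Submodule.mem_sup.1 hv
    rw [add_lie, add_lie, hBs b hb x hx, add_zero]
    exact (Submodule.mem_bot F).1 (hs.2 _ (lie_mem_bracketSpan ha hx))

theorem AdIrreducible.bracket_acts_trivially [FiniteDimensional F L] {S V P E : Submodule F L}
    (hE : AdIrreducible S E) (hES : AdStable S E) (hE0 : E ≠ ⊥)
    (hVS : AdStable S V) (hPS : AdStable S P)
    (hIS : ∀ v ∈ V, ∀ x ∈ P, ⁅v, x⁆ ∈ S)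
    (hIV : ∀ v ∈ V, ∀ x ∈ P, ∀ w ∈ V, ⁅⁅v, x⁆, w⁆ = 0)
    (hnil : ∀ v ∈ V, ∀ x ∈ P, ∀ y ∈ P, ∀ z ∈ P, ∀ t ∈ E,
      ⁅⁅v, x⁆, ⁅⁅v, y⁆, ⁅⁅v, z⁆, t⁆⁆⁆ = 0) :
    ∀ v ∈ V, ∀ x ∈ P, ∀ t ∈ E, ⁅⁅v, x⁆, t⁆ = 0 := by
  obtain ⟨t₀, ht₀, hne, h₀⟩ := exists_common_kernel hPS hIS hIV hnil le_rfl E le_rfl hE0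
    (fun v hv x hx t ht => hES _ (hIS v hv x hx) t ht)
  have hker : ∀ a ∈ bracketSpan V P, ⁅a, t₀⁆ = 0 := by
    have : bracketSpan V P ≤ LinearMap.ker (LieAlgebra.ad F L t₀ : L →ₗ[F] L) := by
      refine bracketSpan_le.2 fun v hv x hx => ?_
      rw [LinearMap.mem_ker, LieAlgebra.ad_apply, ← lie_skew, h₀ v hv x hx, neg_zero]
    intro a ha
    have := this ha
    rw [LinearMap.mem_ker, LieAlgebra.ad_apply] at this
    rw [← lie_skew, this, neg_zero]
  exact fun v hv x hx t ht => hE.lie_eq_zero hES (hVS.bracketSpan hPS) ht₀ hne hker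
    (lie_mem_bracketSpan hv hx) ht

theorem mem_nonnegPart {g : ℤ → Submodule F L} {j : ℤ} (hj : 0 ≤ j) {x : L} (hx : x ∈ g j) :
    x ∈ nonnegPart g :=
  (le_iSup₂_of_le (f := fun j (_ : j ≥ (0 : ℤ)) => g j) j hj le_rfl) hx

/-- A subspace stable under all homogeneous components and containing a nonzero homogeneous
element contains the component of degree `-1`. -/
theorem le_of_adStable_of_mem {g : ℤ → Submodule F L}
    (htop : ⨆ i, g i = ⊤)
    (hgraded : ∀ i j : ℤ, ∀ x ∈ g i, ∀ y ∈ g j, ⁅x, y⁆ ∈ g (i + j))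
    (hirr : AdIrreducible (g 0) (g (-1)))
    (htrans : ∀ x ∈ nonnegPart g, (∀ y ∈ g (-1), ⁅x, y⁆ = 0) → x = 0)
    (hrad : ∀ J : Submodule F L, (∀ x : L, ∀ y ∈ J, ⁅x, y⁆ ∈ J) →
      J ≤ negPart g → J = ⊥)
    {C : Submodule F L} (hC : ∀ i, AdStable (g i) C) {j : ℤ} {c : L} (hcC : c ∈ C)
    (hcj : c ∈ g j) (hc : c ≠ 0) : g (-1) ≤ C := by
  have hnonneg : ∃ k : ℕ, C ⊓ g k ≠ ⊥ := by
    by_contra! h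
    have hJ : (⨆ k, C ⊓ g k) = ⊥ := by
      refine hrad _ (fun x => ?_) (iSup_le fun k => ?_)
      · have hx : x ∈ ⨆ i, g i := htop ▸ Submodule.mem_top
        intro y hy
        induction hx using Submodule.iSup_induction' with
        | mem i x hx =>
          have : (⨆ k, C ⊓ g k) ≤ (⨆ k, C ⊓ g k).comap (LieAlgebra.ad F L x : L →ₗ[F] L) := by
            refine iSup_le fun k z hz => ?_
            exact (le_iSup (fun k => C ⊓ g k) (i + k))
              ⟨hC i x hx z hz.1, hgraded i k x hx z hz.2⟩
          exact this hy
        | zero => simp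
        | add a b _ _ ha hb => rw [add_lie]; exact Submodule.add_mem _ ha hb
      · rcases lt_or_ge k 0 with hk | hk
        · exact inf_le_right.trans
            (le_iSup₂_of_le (f := fun j (_ : j < (0 : ℤ)) => g j) k hk le_rfl)
        · lift k to ℕ using hk
          rw [h k]; exact bot_le
    have : c ∈ ⨆ k, C ⊓ g k := (le_iSup (fun k => C ⊓ g k) j) ⟨hcC, hcj⟩
    rw [hJ] at this
    exact hc ((Submodule.mem_bot F).1 this)
  have hstep : ∀ k : ℤ, 0 ≤ k → C ⊓ g k ≠ ⊥ → C ⊓ g (k - 1) ≠ ⊥ := by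
    intro k hk hne
    obtain ⟨x, hx, hx0⟩ := (Submodule.ne_bot_iff _).1 hne
    by_contra hbot
    refine hx0 (htrans x (mem_nonnegPart hk hx.2) fun y hy => ?_)
    rw [← lie_skew, neg_eq_zero]
    have : ⁅y, x⁆ ∈ C ⊓ g (k - 1) :=
      ⟨hC _ y hy x hx.1, by have := hgraded _ _ y hy x hx.2; rwa [neg_add_eq_sub] at this⟩
    rw [hbot] at this
    exact (Submodule.mem_bot F).1 this
  obtain ⟨k, hk⟩ := hnonneg
  have hneg : C ⊓ g (-1) ≠ ⊥ := by
    induction k with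
    | zero => simpa using hstep 0 le_rfl (by simpa using hk)
    | succ k ih => exact ih (by simpa using hstep (k + 1) (by positivity) (by simpa using hk))
  rcases hirr (C ⊓ g (-1)) inf_le_right
      ((hC 0).inf fun x hx y hy => by simpa using hgraded _ _ x hx y hy) with h | h
  · exact absurd h hneg
  · exact h ▸ inf_le_left

/-- The smallest subspace containing `T` and stable under `S`. -/
def adHull (S T : Submodule F L) : Submodule F L :=
  sInf {N | T ≤ N ∧ AdStable S N}

theorem le_adHull (S T : Submodule F L) : T ≤ adHull S T :=
  le_sInf fun _ h => h.1

theorem adStable_adHull (S T : Submodule F L) : AdStable S (adHull S T) := by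
  intro x hx a ha
  refine Submodule.mem_sInf.2 fun N hN => hN.2 x hx a (Submodule.mem_sInf.1 ha N hN)

theorem adHull_le {S T N : Submodule F L} (h : T ≤ N) (hN : AdStable S N) : adHull S T ≤ N :=
  sInf_le ⟨h, hN⟩

/-- The top component generates, under the component of degree `-1`, a subspace stable under the
whole graded algebra. -/
theorem adStable_adHull_top {g : ℤ → Submodule F L}
    (hgraded : ∀ i j : ℤ, ∀ x ∈ g i, ∀ y ∈ g j, ⁅x, y⁆ ∈ g (i + j)) {r : ℤ}
    (hheight : ∀ j : ℤ, r < j → g j = ⊥)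
    (hgen : ∀ i : ℤ, 2 ≤ i → g (-i) = bracketSpan (g (-1)) (g (-(i - 1)))) (i : ℤ) :
    AdStable (g i) (adHull (g (-1)) (g r)) := by
  set N := adHull (g (-1)) (g r)
  have hN := adStable_adHull (g (-1)) (g r)
  have hneg : ∀ k : ℕ, AdStable (g (-((k : ℤ) + 1))) N := by
    intro k
    induction k with
    | zero => simpa using hN
    | succ k ih =>
      rw [hgen _ (by push_cast; linarith)]
      suffices h : bracketSpan (g (-1)) (g (-(((k + 1 : ℕ) : ℤ) + 1 - 1))) ≤
          transporter N N by
        intro x hx a ha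
        have := N.neg_mem (h hx a ha)
        rwa [lie_skew] at this
      refine bracketSpan_le.2 fun u hu y hy n hn => ?_
      have hy' : y ∈ g (-((k : ℤ) + 1)) := by
        have e : (-(((k + 1 : ℕ) : ℤ) + 1 - 1)) = -((k : ℤ) + 1) := by push_cast; ring
        rwa [e] at hy
      rw [← lie_skew, lie_lie]
      exact N.neg_mem (N.sub_mem (hN u hu _ (ih y hy' n hn)) (ih y hy' _ (hN u hu n hn)))
  have hnonneg : ∀ k : ℕ, AdStable (g ((k : ℤ) - 1)) N := by
    intro k
    induction k with
    | zero => simpa using hN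
    | succ k ih =>
      have hle : N ≤ N ⊓ transporter (g (((k + 1 : ℕ) : ℤ) - 1)) N := by
        refine adHull_le (le_inf (le_adHull _ _) fun y hy x hx => ?_) ?_
        · have := hgraded _ _ x hx y hy
          rcases Nat.eq_zero_or_pos k with rfl | hk
          · exact le_adHull _ _ (by simpa using this)
          · rw [hheight _ (by push_cast; omega)] at this
            rw [(Submodule.mem_bot F).1 this]
            exact N.zero_mem
        · intro u hu n hn
          refine ⟨hN u hu n hn.1, fun x hx => ?_⟩
          rw [leibniz_lie]
          refine N.add_mem (ih _ ?_ n hn.1) (hN u hu _ (hn.2 x hx))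
          have := hgraded _ _ x hx u hu
          have e : (((k + 1 : ℕ) : ℤ) - 1 + -1) = (k : ℤ) - 1 := by push_cast; ring
          rwa [e] at this
      exact fun x hx n hn => (hle hn).2 x hx
  rcases lt_or_ge i 0 with hi | hi
  · obtain ⟨k, hk⟩ : ∃ k : ℕ, i = -((k : ℤ) + 1) := ⟨(-i - 1).toNat, by omega⟩
    exact hk ▸ hneg k
  · obtain ⟨k, hk⟩ : ∃ k : ℕ, i = (k : ℤ) - 1 := ⟨(i + 1).toNat, by omega⟩
    exact hk ▸ hnonneg k

/-- A nonzero submodule `U` of a negative component which centralizes the component of degree `-1`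
is the whole lowest component, and `⁅U, g (q - i)⁆` fills `g (-i)`. -/
theorem eq_depth_of_central {g : ℤ → Submodule F L}
    (htop : ⨆ i, g i = ⊤)
    (hgraded : ∀ i j : ℤ, ∀ x ∈ g i, ∀ y ∈ g j, ⁅x, y⁆ ∈ g (i + j))
    {q r : ℤ} (hqr : q ≤ r)
    (hdepth_ne : g (-q) ≠ ⊥)
    (hdepth : ∀ j : ℤ, q < j → g (-j) = ⊥)
    (hheight_ne : g r ≠ ⊥)
    (hheight : ∀ j : ℤ, r < j → g j = ⊥)
    (hirr : AdIrreducible (g 0) (g (-1)))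
    (htrans : ∀ x ∈ nonnegPart g, (∀ y ∈ g (-1), ⁅x, y⁆ = 0) → x = 0)
    (hrad : ∀ J : Submodule F L, (∀ x : L, ∀ y ∈ J, ⁅x, y⁆ ∈ J) →
      J ≤ negPart g → J = ⊥)
    (hgen : ∀ i : ℤ, 2 ≤ i → g (-i) = bracketSpan (g (-1)) (g (-(i - 1))))
    {U : Submodule F L} {j : ℤ} (hj : 1 ≤ j) (hU : U ≤ g (-j)) (hU0 : U ≠ ⊥)
    (hUS : AdStable (g 0) U) (hcent : ∀ a ∈ U, ∀ u ∈ g (-1), ⁅a, u⁆ = 0) :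
    j = q ∧ U = g (-q) ∧ ∀ i : ℤ, 1 ≤ i → i ≤ q → g (-i) ≤ bracketSpan U (g (q - i)) := by
  have hS : ∀ i, AdStable (g 0) (g i) := fun i x hx y hy => by simpa using hgraded _ _ x hx y hy
  have hjq : j ≤ q := by
    by_contra! h
    exact hU0 (le_bot_iff.1 (hdepth j h ▸ hU))
  have hUr : ∃ a ∈ U, ∃ x ∈ g r, ⁅a, x⁆ ≠ 0 := by
    by_contra! h
    set N := adHull (g (-1)) (g r)
    have hN := adStable_adHull_top hgraded hheight hgen
    have hUN : N ≤ transporter U ⊥ := by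
      refine adHull_le (fun x hx a ha => by simp [h a ha x hx]) fun u hu n hn a ha => ?_
      have := (Submodule.mem_bot F).1 (hn a ha)
      simp [leibniz_lie a u n, hcent a ha u hu, this]
    obtain ⟨a, ha, ha0⟩ := (Submodule.ne_bot_iff U).1 hU0
    have hle := le_of_adStable_of_mem (C := transporter N ⊥) htop hgraded hirr htrans hrad
      (fun i => (hN i).transporter (adStable_bot _))
      (fun n hn => by rw [← lie_skew]; exact Submodule.neg_mem _ (hUN hn a ha)) (hU ha) ha0
    obtain ⟨x, hx, hx0⟩ := (Submodule.ne_bot_iff _).1 hheight_ne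
    exact hx0 (htrans x (mem_nonnegPart (by linarith) hx) fun u hu =>
      (Submodule.mem_bot F).1 (hle hu x (le_adHull _ _ hx)))
  have hUj : ∃ a ∈ U, ∃ x ∈ g (j - 1), ⁅a, x⁆ ≠ 0 := by
    by_contra! h
    have hall : ∀ k : ℕ, ∀ a ∈ U, ∀ x ∈ g (j - 1 + k), ⁅a, x⁆ = 0 := by
      intro k
      induction k with
      | zero => simpa using h
      | succ k ih =>
        intro a ha x hx
        refine htrans _ (mem_nonnegPart (j := k) (by positivity) ?_) fun u hu => ?_
        · have := hgraded _ _ a (hU ha) x hx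
          have e : (-j + (j - 1 + ((k + 1 : ℕ) : ℤ))) = k := by push_cast; ring
          rwa [e] at this
        · have hxu : ⁅x, u⁆ ∈ g (j - 1 + k) := by
            have := hgraded _ _ x hx u hu
            have e : (j - 1 + ((k + 1 : ℕ) : ℤ) + -1) = j - 1 + k := by push_cast; ring
            rwa [e] at this
          rw [lie_lie, ih a ha _ hxu, hcent a ha u hu]; simp
    obtain ⟨a, ha, x, hx, hax⟩ := hUr
    exact hax (hall (r - (j - 1)).toNat a ha x (by
      have e : j - 1 + ((r - (j - 1)).toNat : ℤ) = r := by omega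
      rwa [e]))
  have hspan : ∀ k : ℕ, (k : ℤ) + 1 ≤ j →
      g (-((k : ℤ) + 1)) ≤ bracketSpan U (g (j - ((k : ℤ) + 1))) := by
    intro k
    induction k with
    | zero =>
      intro _
      simp only [Nat.cast_zero, zero_add]
      obtain ⟨a, ha, x, hx, hax⟩ := hUj
      rcases hirr (bracketSpan U (g (j - 1))) (bracketSpan_le.2 fun a ha x hx => by
        have := hgraded _ _ a (hU ha) x hx
        have e : -j + (j - 1) = -1 := by ring
        rwa [e] at this) (hUS.bracketSpan (hS _)) with h | h
      · have := lie_mem_bracketSpan ha hx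
        rw [h] at this
        exact absurd ((Submodule.mem_bot F).1 this) hax
      · exact h.ge
    | succ k ih =>
      intro hk
      push_cast at hk ⊢
      rw [hgen _ (by linarith)]
      refine bracketSpan_le.2 fun u hu y hy => ?_
      have hy' : y ∈ bracketSpan U (g (j - ((k : ℤ) + 1))) := by
        refine ih (by linarith) ?_
        have e : (-((k : ℤ) + 1 + 1 - 1)) = -((k : ℤ) + 1) := by ring
        rwa [e] at hy
      have hle : bracketSpan U (g (j - ((k : ℤ) + 1))) ≤
          (bracketSpan U (g (j - ((k : ℤ) + 1 + 1)))).comap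
            (LieAlgebra.ad F L u : L →ₗ[F] L) := by
        refine bracketSpan_le.2 fun a ha x hx => ?_
        rw [Submodule.mem_comap, LieAlgebra.ad_apply, leibniz_lie, ← lie_skew u a, hcent a ha u hu,
          neg_zero, zero_lie, zero_add]
        refine lie_mem_bracketSpan ha ?_
        have := hgraded _ _ u hu x hx
        have e : -1 + (j - ((k : ℤ) + 1)) = j - ((k : ℤ) + 1 + 1) := by ring
        rwa [e] at this
      exact hle hy'
  have hspan' : ∀ i : ℤ, 1 ≤ i → i ≤ j → g (-i) ≤ bracketSpan U (g (j - i)) := by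
    intro i hi hij
    have := hspan (i - 1).toNat (by omega)
    have e : ((i - 1).toNat : ℤ) + 1 = i := by omega
    rwa [e] at this
  have hUeq : U = g (-j) := by
    refine le_antisymm hU ((hspan' j hj le_rfl).trans (bracketSpan_le.2 fun a ha x hx => ?_))
    rw [← lie_skew]
    exact U.neg_mem (hUS x (by simpa using hx) a ha)
  have hjeq : j = q := by
    by_contra hne
    have hzero : ∀ k : ℕ, g (-(j + 1 + k)) = ⊥ := by
      intro k
      induction k with
      | zero =>
        rw [hgen _ (by push_cast; linarith), eq_bot_iff]
        refine bracketSpan_le.2 fun u hu a ha => ?_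
        have ha' : a ∈ U := by
          rw [hUeq]; simpa using ha
        rw [← lie_skew, hcent a ha' u hu]; simp
      | succ k ih =>
        rw [hgen _ (by push_cast; linarith), eq_bot_iff]
        refine bracketSpan_le.2 fun u hu a ha => ?_
        have e : (-(j + 1 + ((k + 1 : ℕ) : ℤ) - 1)) = -(j + 1 + k) := by push_cast; ring
        rw [e, ih, Submodule.mem_bot] at ha
        simp [ha]
    have := hzero (q - (j + 1)).toNat
    have e : j + 1 + ((q - (j + 1)).toNat : ℤ) = q := by omega
    rw [e] at this
    exact hdepth_ne this
  subst hjeq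
  exact ⟨rfl, hUeq, hspan'⟩

/-- The key identity: `x₁, x₂, x₃` raise, `v` lowers, and `⁅v, xᵢ⁆` commutes with `v`. -/
theorem lie_cubic_eq_zero (h2 : (2 : F) ≠ 0) {v x₁ x₂ x₃ t c : L}
    (hvt : ⁅v, t⁆ = 0) (hvc : ⁅v, c⁆ = 0)
    (hv₁ : ⁅v, ⁅v, x₁⁆⁆ = 0) (hv₂ : ⁅v, ⁅v, x₂⁆⁆ = 0) (hv₃ : ⁅v, ⁅v, x₃⁆⁆ = 0)
    (hvv : ⁅v, ⁅v, ⁅⁅x₂, ⁅x₃, t⁆⁆, ⁅x₁, c⁆⁆⁆⁆ = 0)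
    (htc : ⁅⁅⁅v, x₂⁆, ⁅⁅v, x₃⁆, t⁆⁆, c⁆ = 0)
    (hIc : ⁅⁅v, x₁⁆, ⁅⁅⁅v, x₂⁆, ⁅x₃, t⁆⁆ + ⁅x₂, ⁅⁅v, x₃⁆, t⁆⁆, c⁆⁆ = 0) :
    ⁅⁅x₁, ⁅⁅v, x₂⁆, ⁅⁅v, x₃⁆, t⁆⁆⁆ +
      ⁅⁅v, x₁⁆, ⁅⁅v, x₂⁆, ⁅x₃, t⁆⁆ + ⁅x₂, ⁅⁅v, x₃⁆, t⁆⁆⁆, c⁆ = 0 := by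
  have hvb : ⁅v, ⁅x₁, c⁆⁆ = ⁅⁅v, x₁⁆, c⁆ := by rw [leibniz_lie, hvc, lie_zero, add_zero]
  have hvvb : ⁅v, ⁅⁅v, x₁⁆, c⁆⁆ = 0 := by
    rw [leibniz_lie, hv₁, hvc, zero_lie, lie_zero, add_zero]
  have hvx₃ : ⁅v, ⁅x₃, t⁆⁆ = ⁅⁅v, x₃⁆, t⁆ := by rw [leibniz_lie, hvt, lie_zero, add_zero]
  have hvh₃ : ⁅v, ⁅⁅v, x₃⁆, t⁆⁆ = 0 := by
    rw [leibniz_lie, hv₃, hvt, zero_lie, lie_zero, add_zero]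
  have hva : ⁅v, ⁅x₂, ⁅x₃, t⁆⁆⁆ = ⁅⁅v, x₂⁆, ⁅x₃, t⁆⁆ + ⁅x₂, ⁅⁅v, x₃⁆, t⁆⁆ := by
    rw [leibniz_lie, hvx₃]
  set s := ⁅⁅v, x₂⁆, ⁅⁅v, x₃⁆, t⁆⁆ with hs
  set d := ⁅⁅v, x₂⁆, ⁅x₃, t⁆⁆ + ⁅x₂, ⁅⁅v, x₃⁆, t⁆⁆ with hd
  have hvva : ⁅v, d⁆ = (2 : F) • s := by
    rw [hd, lie_add, leibniz_lie v ⁅v, x₂⁆, leibniz_lie v x₂, hv₂, hvx₃, hvh₃, zero_lie, lie_zero,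
      two_smul]
    abel
  rw [leibniz_lie v ⁅x₂, ⁅x₃, t⁆⁆, hva, hvb, lie_add, leibniz_lie v d, hvva, hvb,
    leibniz_lie v ⁅x₂, ⁅x₃, t⁆⁆, hva, hvvb, lie_zero, add_zero, smul_lie] at hvv
  have hsum : ⁅s, ⁅x₁, c⁆⁆ + ⁅d, ⁅⁅v, x₁⁆, c⁆⁆ = 0 := by
    have : (2 : F) • (⁅s, ⁅x₁, c⁆⁆ + ⁅d, ⁅⁅v, x₁⁆, c⁆⁆) = 0 := by
      rw [← hvv, smul_add, two_smul F ⁅d, ⁅⁅v, x₁⁆, c⁆⁆]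
      abel
    exact (smul_eq_zero.1 this).resolve_left h2
  have e₁ : ⁅⁅x₁, s⁆, c⁆ = -⁅s, ⁅x₁, c⁆⁆ := by rw [lie_lie, htc, lie_zero, zero_sub]
  have e₂ : ⁅⁅⁅v, x₁⁆, d⁆, c⁆ = -⁅d, ⁅⁅v, x₁⁆, c⁆⁆ := by
    rw [lie_lie ⁅v, x₁⁆ d c, hIc, zero_sub]
  rw [add_lie, e₁, e₂, ← neg_add, hsum, neg_zero]

end GradedLie

/-- In a graded Lie algebra of depth `q` and height `r` satisfying conditions (1.6),
with `3 < q ≤ r`, for any irreducible `g 0`-submodule `V` of `g (-q+1)` one has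
`⁅V, ⁅V, g (q-1)⁆⁆ ≠ 0`. -/
theorem statement12 {F L : Type*} [Field F] [LieRing L] [LieAlgebra F L]
    [FiniteDimensional F L]
    (hchar2 : ringChar F ≠ 2) (hchar3 : ringChar F ≠ 3)
    (g : ℤ → Submodule F L)
    (hdirect : DirectSum.IsInternal g)
    (hgraded : ∀ i j : ℤ, ∀ x ∈ g i, ∀ y ∈ g j, ⁅x, y⁆ ∈ g (i + j))
    -- depth q and height r
    (q r : ℤ) (hq : 3 < q) (hqr : q ≤ r)
    (hdepth_ne : g (-q) ≠ ⊥)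
    (hdepth : ∀ j : ℤ, q < j → g (-j) = ⊥)
    (hheight_ne : g r ≠ ⊥)
    (hheight : ∀ j : ℤ, r < j → g j = ⊥)
    -- irreducibility
    (hirr_ne : g (-1) ≠ ⊥)
    (hirr : ∀ W : Submodule F L, W ≤ g (-1) →
      (∀ x ∈ g 0, ∀ w ∈ W, ⁅x, w⁆ ∈ W) → W = ⊥ ∨ W = g (-1))
    -- transitivity
    (htrans : ∀ x ∈ nonnegPart g, (∀ y ∈ g (-1), ⁅x, y⁆ = 0) → x = 0)
    -- the only Lie ideal contained in the negative part is zero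
    (hrad : ∀ J : Submodule F L, (∀ x : L, ∀ y ∈ J, ⁅x, y⁆ ∈ J) →
      J ≤ negPart g → J = ⊥)
    -- g₋ᵢ = ⁅g₋₁, g₋₍ᵢ₋₁₎⁆ for all i ≥ 2
    (hgen : ∀ i : ℤ, 2 ≤ i → g (-i) = bracketSpan (g (-1)) (g (-(i - 1))))
    -- V is an irreducible g 0-submodule of g (-q+1)
    (V : Submodule F L)
    (hVle : V ≤ g (-q + 1))
    (hVne : V ≠ ⊥)
    (hVstab : ∀ x ∈ g 0, ∀ v ∈ V, ⁅x, v⁆ ∈ V)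
    (hVirr : ∀ W : Submodule F L, W ≤ V →
      (∀ x ∈ g 0, ∀ w ∈ W, ⁅x, w⁆ ∈ W) → W = ⊥ ∨ W = V) :
    ∃ v' ∈ V, ∃ v ∈ V, ∃ z ∈ g (q - 1), ⁅v', ⁅v, z⁆⁆ ≠ 0 := by
  by_contra! hVV
  have h2 : (2 : F) ≠ 0 := Ring.two_ne_zero hchar2
  have h3 : (3 : F) ≠ 0 := by
    intro h
    have hdvd : ringChar F ∣ 3 := ringChar.dvd (by exact_mod_cast h)
    rcases (Nat.dvd_prime Nat.prime_three).1 hdvd with h | h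
    · exact CharP.ringChar_ne_one h
    · exact hchar3 h
  have hirr' : AdIrreducible (g 0) (g (-1)) := hirr
  have htop := hdirect.submodule_iSup_eq_top
  have hmem : ∀ {i j k : ℤ} {x y : L}, x ∈ g i → y ∈ g j → i + j = k → ⁅x, y⁆ ∈ g k := by
    rintro i j _ x y hx hy rfl
    exact hgraded i j x hx y hy
  have hzero : ∀ {j : ℤ} {x : L}, x ∈ g j → j < -q → x = 0 := by
    intro j x hx hj
    have := hdepth (-j) (by linarith)
    rw [neg_neg] at this
    rwa [this, Submodule.mem_bot] at hx
  have hS : ∀ i, AdStable (g 0) (g i) := fun i x hx y hy => hmem hx hy (zero_add i)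
  have hcentral := fun (U : Submodule F L) (j : ℤ) =>
    eq_depth_of_central (U := U) (j := j) htop hgraded hqr hdepth_ne hdepth hheight_ne hheight
      hirr htrans hrad hgen
  have hQcomm : ∀ a ∈ g (-q), ∀ u ∈ g (-1), ⁅a, u⁆ = 0 := fun a ha u hu =>
    hzero (hmem ha hu rfl) (by linarith)
  obtain ⟨-, -, hQspan⟩ := hcentral (g (-q)) q (by linarith) le_rfl hdepth_ne (hS _) hQcomm
  have hQirr : AdIrreducible (g 0) (g (-q)) := fun W hW hWS => or_iff_not_imp_left.2 fun hW0 =>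
    (hcentral W q (by linarith) hW hW0 hWS fun a ha => hQcomm a (hW ha)).2.1
  -- `V` does not centralize `g (-1)`
  have hVinj : ∀ u ∈ g (-1), (∀ v ∈ V, ⁅v, u⁆ = 0) → u = 0 := by
    intro u hu h
    by_contra hu0
    have := (hcentral V (q - 1) (by linarith) (by convert hVle using 2; ring) hVne hVstab
      fun v hv w hw => hirr'.lie_eq_zero (hS _) hVstab hu hu0 h hv hw).1
    linarith
  have hVQ : ∀ {v u : L}, v ∈ V → u ∈ g (-1) → ⁅v, u⁆ ∈ g (-q) := fun hv hu =>
    hmem (hVle hv) hu (by ring)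
  have hVQ0 : ∀ {v t : L}, v ∈ V → t ∈ g (-q) → ⁅v, t⁆ = 0 := fun hv ht =>
    hzero (hmem (hVle hv) ht rfl) (by linarith)
  obtain ⟨u₀, hu₀, hu₀0⟩ := (Submodule.ne_bot_iff _).1 hirr_ne
  have hQpos : ∃ x ∈ g (q - 1), ∃ t ∈ g (-q), ⁅x, t⁆ ≠ 0 := by
    by_contra! h
    have hle := (hQspan 1 le_rfl (by linarith)).trans (bracketSpan_le (C := ⊥).2 fun t ht x hx => by
      rw [← lie_skew, h x hx t ht]; simp)
    exact hu₀0 ((Submodule.mem_bot F).1 (hle hu₀))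
  have hQpos' : ∀ t ∈ g (-q), (∀ x ∈ g (q - 1), ⁅x, t⁆ = 0) → t = 0 := by
    intro t ht h
    by_contra ht0
    obtain ⟨x, hx, s, hs, hxs⟩ := hQpos
    exact hxs (hQirr.lie_eq_zero (hS _) (hS _) ht ht0 h hx hs)
  have hI : ∀ v ∈ V, ∀ x ∈ g (q - 1), ⁅v, x⁆ ∈ g 0 := fun v hv x hx =>
    hmem (hVle hv) hx (by ring)
  have hIV : ∀ v ∈ V, ∀ x ∈ g (q - 1), ∀ w ∈ V, ⁅⁅v, x⁆, w⁆ = 0 := fun v hv x hx w hw => by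
    rw [← lie_skew, hVV w hw v hv x hx, neg_zero]
  -- `⁅V, g (q - 1)⁆ ≠ 0`
  have hI0 : ¬ ∀ v ∈ V, ∀ x ∈ g (q - 1), ⁅v, x⁆ = 0 := by
    intro h
    have hcomm : ∀ v ∈ V, ∀ x ∈ g (q - 1), ∀ y : L, ⁅v, ⁅x, y⁆⁆ = ⁅x, ⁅v, y⁆⁆ := by
      intro v hv x hx y
      rw [leibniz_lie, h v hv x hx, zero_lie, zero_add]
    refine hu₀0 (hVinj u₀ hu₀ fun v hv => hQpos' _ (hVQ hv hu₀) fun x hx => ?_)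
    refine hVinj _ (hmem hx (hVQ hv hu₀) (by ring)) fun w hw => ?_
    rw [hcomm w hw x hx, hVQ0 hw (hVQ hv hu₀), lie_zero]
  have hI1 : ¬ ∀ v ∈ V, ∀ x ∈ g (q - 1), ∀ u ∈ g (-1), ⁅⁅v, x⁆, u⁆ = 0 := fun h =>
    hI0 fun v hv x hx => htrans _ (mem_nonnegPart le_rfl (hI v hv x hx)) (h v hv x hx)
  -- `⁅V, g (q - 2)⁆ ≠ 0`
  have hV2 : ∃ v ∈ V, ∃ x ∈ g (q - 2), ⁅v, x⁆ ≠ 0 := by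
    by_contra! h
    have hh : ∀ v ∈ V, ∀ x ∈ g (q - 1), ∀ u ∈ g (-1), ⁅⁅v, x⁆, u⁆ = -⁅x, ⁅v, u⁆⁆ := by
      intro v hv x hx u hu
      rw [lie_lie, h v hv _ (hmem hx hu (by ring)), zero_sub]
    have hvh : ∀ v ∈ V, ∀ x ∈ g (q - 1), ∀ u ∈ g (-1), ⁅v, ⁅⁅v, x⁆, u⁆⁆ = 0 := by
      intro v hv x hx u hu
      have hc : ⁅v, ⁅⁅v, x⁆, u⁆⁆ = ⁅⁅v, x⁆, ⁅v, u⁆⁆ := by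
        rw [leibniz_lie, hVV v hv v hv x hx, zero_lie, zero_add]
      have hneg := congrArg (fun y => ⁅v, y⁆) (hh v hv x hx u hu)
      simp only [lie_neg] at hneg
      rw [leibniz_lie v x, hVQ0 hv (hVQ hv hu), lie_zero, add_zero, ← hc] at hneg
      have htwo : (2 : F) • ⁅v, ⁅⁅v, x⁆, u⁆⁆ = 0 := by
        rw [two_smul]
        exact add_eq_zero_iff_eq_neg.2 hneg
      exact (smul_eq_zero.1 htwo).resolve_left h2
    refine hI1 (hirr'.bracket_acts_trivially (hS _) hirr_ne hVstab (hS _) hI hIV ?_)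
    intro v hv x hx y hy z hz u hu
    rw [hh v hv y hy _ (hS _ _ (hI v hv z hz) _ hu), hvh v hv z hz u hu, lie_zero, neg_zero,
      lie_zero]
  -- `V` is the whole component
  have hVeq : g (-q + 1) ≤ V := by
    obtain ⟨v, hv, x, hx, hvx⟩ := hV2
    have hu : ⁅v, x⁆ ∈ g (-1) := hmem (hVle hv) hx (by ring)
    obtain ⟨w, hw, ht⟩ : ∃ w ∈ V, ⁅w, ⁅v, x⁆⁆ ≠ 0 := by
      by_contra! h
      exact hvx (hVinj _ hu h)
    have hu' : ⁅w, x⁆ ∈ g (-1) := hmem (hVle hw) hx (by ring)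
    have hty : ∀ y ∈ g 1, ⁅y, ⁅w, ⁅v, x⁆⁆⁆ ∈ V := by
      intro y hy
      have h₁ : ⁅w, ⁅v, ⁅x, y⁆⁆⁆ = 0 := hVV w hw v hv _ (hmem hx hy (by ring))
      have h₂ : ⁅w, ⁅v, y⁆⁆ = 0 :=
        hzero (hmem (hVle hw) (hmem (hVle hv) hy rfl) rfl) (by linarith)
      have hvw : ⁅v, w⁆ = 0 := hzero (hmem (hVle hv) (hVle hw) rfl) (by linarith)
      have h₃ : ⁅w, ⁅v, x⁆⁆ = ⁅v, ⁅w, x⁆⁆ := by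
        rw [leibniz_lie v w x, hvw, zero_lie, zero_add]
      have h₄ : ⁅⁅w, ⁅v, x⁆⁆, y⁆ = ⁅w, ⁅⁅v, x⁆, y⁆⁆ + ⁅v, ⁅⁅w, x⁆, y⁆⁆ := by
        rw [leibniz_lie v x y, lie_add, leibniz_lie w x, h₂, lie_zero, add_zero] at h₁
        rw [leibniz_lie v ⁅w, x⁆ y, ← h₃, ← add_assoc, add_right_comm, h₁, zero_add]
      rw [← lie_skew, h₄]
      refine V.neg_mem (V.add_mem ?_ ?_)
      · rw [← lie_skew]
        exact V.neg_mem (hVstab _ (hmem hu hy (by ring)) w hw)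
      · rw [← lie_skew]
        exact V.neg_mem (hVstab _ (hmem hu' hy (by ring)) v hv)
    have hQV : ∀ y ∈ g 1, ∀ t ∈ g (-q), ⁅y, t⁆ ∈ V := fun y hy t ht' =>
      hQirr.lie_mem (hS _) (hS 1) hVstab (hVQ hw hu) ht hty hy ht'
    have := hQspan (q - 1) (by linarith) (by linarith)
    rw [sub_sub_cancel, neg_sub, sub_eq_neg_add] at this
    refine this.trans (bracketSpan_le.2 fun t ht y hy => ?_)
    rw [← lie_skew]
    exact V.neg_mem (hQV y hy t ht)
  have hIg : ∀ v ∈ V, ∀ x ∈ g (q - 1), ∀ w ∈ g (-q + 1), ⁅⁅v, x⁆, w⁆ = 0 :=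
    fun v hv x hx w hw => hIV v hv x hx w (hVeq hw)
  have hPinj : ∀ u ∈ g (-1), (∀ c ∈ g (-q + 2), ⁅c, u⁆ = 0) → u = 0 := by
    intro u hu h
    by_contra hu0
    obtain ⟨v, hv, hv0⟩ := (Submodule.ne_bot_iff _).1 hVne
    have hgq := hgen (q - 1) (by linarith)
    have e₁ : -(q - 1) = -q + 1 := by ring
    have e₂ : -(q - 1 - 1) = -q + 2 := by ring
    rw [e₁, e₂] at hgq
    have hle : g (-q + 1) ≤ ⊥ := hgq.trans_le <| bracketSpan_le.2 fun w hw c hc => by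
      rw [← lie_skew, hirr'.lie_eq_zero (hS _) (hS _) hu hu0 h hc hw]; simp
    exact hv0 ((Submodule.mem_bot F).1 (hle (hVle hv)))
  have hIQ : ∀ v ∈ V, ∀ x ∈ g (q - 1), ∀ t ∈ g (-q), ⁅⁅v, x⁆, t⁆ = 0 := by
    refine hQirr.bracket_acts_trivially (hS _) hdepth_ne hVstab (hS _) hI hIV ?_
    intro v hv x₁ hx₁ x₂ hx₂ x₃ hx₃ t ht
    have hh₁ := hI v hv x₁ hx₁
    have hh₂ := hI v hv x₂ hx₂
    have hh₃ := hI v hv x₃ hx₃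
    have hs : ⁅⁅v, x₂⁆, ⁅⁅v, x₃⁆, t⁆⁆ ∈ g (-q) := hS _ _ hh₂ _ (hS _ _ hh₃ _ ht)
    have hd : ⁅⁅v, x₂⁆, ⁅x₃, t⁆⁆ + ⁅x₂, ⁅⁅v, x₃⁆, t⁆⁆ ∈ g (-1) :=
      Submodule.add_mem _ (hS _ _ hh₂ _ (hmem hx₃ ht (by ring)))
        (hmem hx₂ (hS _ _ hh₃ _ ht) (by ring))
    have hY : ⁅x₁, ⁅⁅v, x₂⁆, ⁅⁅v, x₃⁆, t⁆⁆⁆ +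
        ⁅⁅v, x₁⁆, ⁅⁅v, x₂⁆, ⁅x₃, t⁆⁆ + ⁅x₂, ⁅⁅v, x₃⁆, t⁆⁆⁆ = 0 := by
      refine hPinj _ (Submodule.add_mem _ (hmem hx₁ hs (by ring)) (hS _ _ hh₁ _ hd))
        fun c hc => ?_
      rw [← lie_skew, neg_eq_zero]
      refine lie_cubic_eq_zero h2 (hVQ0 hv ht) (hzero (hmem (hVle hv) hc rfl) (by linarith))
        (hVV v hv v hv x₁ hx₁) (hVV v hv v hv x₂ hx₂) (hVV v hv v hv x₃ hx₃)
        (hVV v hv v hv _ (hmem (hmem hx₂ (hmem hx₃ ht rfl) rfl) (hmem hx₁ hc rfl) (by ring)))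
        (hzero (hmem hs hc rfl) (by linarith))
        (hIg v hv x₁ hx₁ _ (hmem hd hc (by ring)))
    have hcomm : ∀ x ∈ g (q - 1), ∀ y : L, ⁅v, ⁅⁅v, x⁆, y⁆⁆ = ⁅⁅v, x⁆, ⁅v, y⁆⁆ := by
      intro x hx y
      rw [leibniz_lie, hVV v hv v hv x hx, zero_lie, zero_add]
    have hvY := congrArg (fun y => ⁅v, y⁆) hY
    simp only [lie_add, lie_zero, hcomm _ hx₁, hcomm _ hx₂, hcomm _ hx₃, leibniz_lie v x₁,
      leibniz_lie v x₂, leibniz_lie v x₃, hVQ0 hv ht, add_zero] at hvY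
    have hthree : (3 : F) • ⁅⁅v, x₁⁆, ⁅⁅v, x₂⁆, ⁅⁅v, x₃⁆, t⁆⁆⁆ = 0 := by
      rw [← hvY]
      module
    exact (smul_eq_zero.1 hthree).resolve_left h3
  refine hI1 fun v hv x hx u hu => hVinj _ (hS _ _ (hI v hv x hx) _ hu) fun w hw => ?_
  rw [leibniz_lie, hVV w hw v hv x hx, zero_lie, zero_add]
  exact hIQ v hv x hx _ (hVQ hw hu)
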